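/- Let Δ ≥ 4 be a natural number, let G be a connected locally finite Δ-regular simple graph, let r be a vertex, and let c be an edge colouring of G with colours red and blue such that: the only automorphism of G fixing r and preserving c is the identity; there is a neighbour x of r such that the set of vertices all of whose incident edges are red is exactly {r, x}; for every k with 1 ≤ k ≤ Δ, r has a neighbour with exactly k incident red edges; y is the unique neighbour of x with exactly one incident blue edge; y is not adjacent to r; z is the other endpoint of the unique blue edge incident to y; and k₀ is the number of blue edges incident to z. Then there exists a neighbour w of r with w ≠ x and w ≠ z such that the number of blue edges incident to w is different from k₀ − 1, and for any such w the colouring obtained from c by recolouring the edge rw to blue is a distinguishing colouring of G. -/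

import Mathlib

open SimpleGraph

/-- The number of red edges incident to a vertex `v`, for an edge colouring
`c : G.edgeSet → Bool`, where `true` stands for red and `false` for blue. -/
noncomputable def redCount {V : Type*} (G : SimpleGraph V) (c : G.edgeSet → Bool) (v : V) : ℕ :=
  Set.ncard {u : V | ∃ h : G.Adj v u, c ⟨s(v, u), (G.mem_edgeSet).mpr h⟩ = true}

/-- The number of blue edges incident to a vertex `v`. -/
noncomputable def blueCount {V : Type*} (G : SimpleGraph V) (c : G.edgeSet → Bool) (v : V) : ℕ :=
  Set.ncard {u : V | ∃ h : G.Adj v u, c ⟨s(v, u), (G.mem_edgeSet).mpr h⟩ = false}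

/-- The set of vertices all of whose incident edges are red (`true` = red). -/
def allRedVertices {V : Type*} (G : SimpleGraph V) (c : G.edgeSet → Bool) : Set V :=
  {v : V | ∀ e : G.edgeSet, v ∈ (e : Sym2 V) → c e = true}

/-- The set of neighbours of `v` joined to it by a blue edge. -/
def blueNeighbors {V : Type*} (G : SimpleGraph V) (c : G.edgeSet → Bool) (v : V) : Set V :=
  {u : V | ∃ h : G.Adj v u, c ⟨s(v, u), (G.mem_edgeSet).mpr h⟩ = false}

section

variable {V : Type*} {G : SimpleGraph V} {c c' : G.edgeSet → Bool}

lemma mem_blueNeighbors {v u : V} :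
    u ∈ blueNeighbors G c v ↔
      ∃ h : G.Adj v u, c ⟨s(v, u), (G.mem_edgeSet).mpr h⟩ = false :=
  Iff.rfl

lemma blueCount_eq_ncard (v : V) : blueCount G c v = (blueNeighbors G c v).ncard :=
  rfl

lemma blueNeighbors_finite [G.LocallyFinite] (v : V) : (blueNeighbors G c v).Finite :=
  (Set.toFinite (G.neighborSet v)).subset fun _ hu ↦ hu.1

lemma redCount_add_blueCount [G.LocallyFinite] (v : V) :
    redCount G c v + blueCount G c v = G.degree v := by
  have hfin : (G.neighborSet v).Finite := Set.toFinite _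
  rw [redCount, blueCount, ← Set.ncard_union_eq ?_ (hfin.subset fun _ hu ↦ hu.1)
    (hfin.subset fun _ hu ↦ hu.1), ← G.card_neighborSet_eq_degree,
    Set.fintypeCard_eq_ncard (s := G.neighborSet v)]
  · congr 1
    ext u
    simp only [Set.mem_union, Set.mem_ofPred_eq, mem_neighborSet]
    constructor
    · rintro (⟨h, _⟩ | ⟨h, _⟩) <;> exact h
    · intro h
      cases hc : c ⟨s(v, u), (G.mem_edgeSet).mpr h⟩
      · exact Or.inr ⟨h, hc⟩
      · exact Or.inl ⟨h, hc⟩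
  · rw [Set.disjoint_left]
    rintro u ⟨h, h₁⟩ ⟨_, h₂⟩
    simp [h₁] at h₂

lemma mem_allRedVertices_iff {v : V} :
    v ∈ allRedVertices G c ↔ blueNeighbors G c v = ∅ := by
  rw [Set.eq_empty_iff_forall_notMem]
  constructor
  · rintro hv u ⟨h, hu⟩
    simp [hv ⟨s(v, u), (G.mem_edgeSet).mpr h⟩ (Sym2.mem_mk_left v u)] at hu
  · rintro hv ⟨e, he⟩ hve
    obtain ⟨u, rfl⟩ := Sym2.mem_iff_exists.mp hve
    by_contra hred
    exact hv u ⟨(G.mem_edgeSet).mp he, by simpa using hred⟩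

lemma blueNeighbors_apply {φ : G ≃g G} (hφ : ∀ e : G.edgeSet, c (φ.mapEdgeSet e) = c e) (v : V) :
    blueNeighbors G c (φ v) = φ '' blueNeighbors G c v := by
  have key (u : V) : φ u ∈ blueNeighbors G c (φ v) ↔ u ∈ blueNeighbors G c v := by
    constructor
    · rintro ⟨h, hu⟩
      exact ⟨φ.map_adj_iff.mp h,
        (hφ ⟨s(v, u), (G.mem_edgeSet).mpr (φ.map_adj_iff.mp h)⟩).symm.trans hu⟩
    · rintro ⟨h, hu⟩
      exact ⟨φ.map_adj_iff.mpr h, (hφ ⟨s(v, u), (G.mem_edgeSet).mpr h⟩).trans hu⟩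
  ext u
  obtain ⟨u, rfl⟩ := φ.surjective u
  rw [key, φ.injective.mem_set_image]

lemma blueCount_apply {φ : G ≃g G} (hφ : ∀ e : G.edgeSet, c (φ.mapEdgeSet e) = c e) (v : V) :
    blueCount G c (φ v) = blueCount G c v := by
  rw [blueCount_eq_ncard, blueNeighbors_apply hφ, Set.ncard_image_of_injective _ φ.injective,
    blueCount_eq_ncard]

lemma mem_blueNeighbors_recolour {r w : V} (hrw : G.Adj r w)
    (hc' : ∀ e : G.edgeSet, ((e : Sym2 V) = s(r, w) → c' e = false) ∧
      ((e : Sym2 V) ≠ s(r, w) → c' e = c e)) {v u : V} :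
    u ∈ blueNeighbors G c' v ↔ u ∈ blueNeighbors G c v ∨ s(v, u) = s(r, w) := by
  by_cases h : s(v, u) = s(r, w)
  · have hvu : G.Adj v u := by rwa [← G.mem_edgeSet, h]
    exact iff_of_true ⟨hvu, (hc' ⟨s(v, u), hvu⟩).1 h⟩ (Or.inr h)
  · simp only [mem_blueNeighbors, h, or_false]
    exact exists_congr fun hvu ↦ by rw [(hc' ⟨s(v, u), hvu⟩).2 h]

/-- An automorphism fixing both ends of a recoloured red edge and preserving the new colouring
preserves the old one. -/
lemma preserves_of_preserves_recolour {r w : V}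
    (hc' : ∀ e : G.edgeSet, ((e : Sym2 V) = s(r, w) → c' e = false) ∧
      ((e : Sym2 V) ≠ s(r, w) → c' e = c e))
    {φ : G ≃g G} (hφ : ∀ e : G.edgeSet, c' (φ.mapEdgeSet e) = c' e)
    (hr : φ r = r) (hw : φ w = w) (e : G.edgeSet) : c (φ.mapEdgeSet e) = c e := by
  have hval : (φ.mapEdgeSet e : Sym2 V) = Sym2.map φ e := rfl
  have hfix : Sym2.map φ s(r, w) = s(r, w) := by rw [Sym2.map_mk, hr, hw]
  by_cases h : (e : Sym2 V) = s(r, w)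
  · congr 1
    exact Subtype.ext (by rw [hval, h, hfix])
  · rw [← (hc' e).2 h, ← hφ e]
    refine ((hc' _).2 fun h' ↦ h ?_).symm
    exact Sym2.map.injective φ.injective (by rw [← hval, h', hfix])

end

/-- Case 2 of the proof of the main theorem: with `c` as in Claim 5, the all-red vertices
being exactly `{r, x}` for a neighbour `x` of `r`, `y` the unique neighbour of `x` with
exactly one incident blue edge, `y` not adjacent to `r`, `z` the other endpoint of the
unique blue edge at `y`, and `k₀` the number of blue edges at `z`: there is a neighbour
`w` of `r`, distinct from `x` and `z`, whose number of incident blue edges differs from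
`k₀ - 1`, and for any such `w`, recolouring the edge `rw` blue gives a distinguishing
colouring of `G`. -/
theorem stmt_8 {V : Type*} (G : SimpleGraph V) [G.LocallyFinite]
    (Δ : ℕ) (hΔ : 4 ≤ Δ) (hconn : G.Connected) (hreg : G.IsRegularOfDegree Δ)
    (r x y z : V) (k₀ : ℕ) (c : G.edgeSet → Bool)
    (hdist : ∀ φ : G ≃g G, φ r = r →
      (∀ e : G.edgeSet, c (φ.mapEdgeSet e) = c e) → ∀ v : V, φ v = v)
    (hx : G.Adj r x) (hredset : allRedVertices G c = {r, x})
    (hk : ∀ k : ℕ, 1 ≤ k → k ≤ Δ → ∃ w : V, G.Adj r w ∧ redCount G c w = k)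
    (hxy : G.Adj x y) (hy : blueCount G c y = 1)
    (hyuniq : ∀ y' : V, G.Adj x y' → blueCount G c y' = 1 → y' = y)
    (hry : ¬ G.Adj r y)
    (hyz : G.Adj y z) (hzblue : c ⟨s(y, z), (G.mem_edgeSet).mpr hyz⟩ = false)
    (hk₀ : blueCount G c z = k₀) :
    (∃ w : V, G.Adj r w ∧ w ≠ x ∧ w ≠ z ∧ blueCount G c w ≠ k₀ - 1) ∧
    (∀ w : V, G.Adj r w → w ≠ x → w ≠ z → blueCount G c w ≠ k₀ - 1 →
      ∀ c' : G.edgeSet → Bool,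
        (∀ e : G.edgeSet,
          ((e : Sym2 V) = s(r, w) → c' e = false) ∧
          ((e : Sym2 V) ≠ s(r, w) → c' e = c e)) →
        ∀ φ : G ≃g G, (∀ e : G.edgeSet, c' (φ.mapEdgeSet e) = c' e) → ∀ v : V, φ v = v) := by
  have hpos {v : V} (hr : v ≠ r) (hx : v ≠ x) : blueCount G c v ≠ 0 := by
    intro h0
    have hv : v ∈ allRedVertices G c :=
      mem_allRedVertices_iff.mpr ((Set.ncard_eq_zero (blueNeighbors_finite v)).mp h0)
    rw [hredset] at hv
    exact hv.elim hr hx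
  have hr0 : blueNeighbors G c r = ∅ := mem_allRedVertices_iff.mp (by simp [hredset])
  have hx0 : blueNeighbors G c x = ∅ := mem_allRedVertices_iff.mp (by simp [hredset])
  refine ⟨?_, ?_⟩
  · have hsum (v : V) : redCount G c v + blueCount G c v = Δ := by
      rw [redCount_add_blueCount, hreg v]
    have hbx : blueCount G c x = 0 := by rw [blueCount_eq_ncard, hx0, Set.ncard_empty]
    obtain ⟨w₁, ha₁, hw₁⟩ := hk 1 (by omega) (by omega)
    obtain ⟨w₂, ha₂, hw₂⟩ := hk 2 (by omega) (by omega)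
    obtain ⟨w₃, ha₃, hw₃⟩ := hk 3 (by omega) (by omega)
    have h₁ := hsum w₁
    have h₂ := hsum w₂
    have h₃ := hsum w₃
    by_contra! hno
    have hcand (w : V) (ha : G.Adj r w) (hw : blueCount G c w ≠ 0) :
        blueCount G c w = k₀ ∨ blueCount G c w = k₀ - 1 := by
      by_cases hwz : w = z
      · exact Or.inl (hwz ▸ hk₀)
      · exact Or.inr (hno w ha (fun h ↦ hw (h ▸ hbx)) hwz)
    have := hcand w₁ ha₁ (by omega)
    have := hcand w₂ ha₂ (by omega)
    have := hcand w₃ ha₃ (by omega)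
    omega
  · intro w hrw hwx hwz hwk c' hc' φ hφ
    have hmem {v u : V} := mem_blueNeighbors_recolour hrw hc' (v := v) (u := u)
    have hother {v : V} (hvr : v ≠ r) (hvw : v ≠ w) :
        blueNeighbors G c' v = blueNeighbors G c v := by
      ext u
      simp [hmem, hvr, hvw]
    have hr' : blueNeighbors G c' r = {w} := by
      ext u
      simp [hmem, hr0, hrw.ne]
    have hw' : blueCount G c' w = blueCount G c w + 1 := by
      have hins : blueNeighbors G c' w = insert r (blueNeighbors G c w) := by
        ext u
        simp [hmem, hrw.ne', or_comm]
      have hnot : r ∉ blueNeighbors G c w := by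
        rintro ⟨h, hb⟩
        have : w ∈ blueNeighbors G c r := ⟨h.symm, by simpa only [Sym2.eq_swap] using hb⟩
        simp [hr0] at this
      rw [blueCount_eq_ncard, hins, Set.ncard_insert_of_notMem hnot (blueNeighbors_finite w),
        blueCount_eq_ncard]
    have hcount {v : V} (hvr : v ≠ r) (hvw : v ≠ w) : blueCount G c' v = blueCount G c v := by
      rw [blueCount_eq_ncard, hother hvr hvw, blueCount_eq_ncard]
    have hwpos : blueCount G c w ≠ 0 := hpos hrw.ne' hwx
    have hcr' : blueCount G c' r = 1 := by rw [blueCount_eq_ncard, hr', Set.ncard_singleton]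
    have hzy : z ∈ blueNeighbors G c y := ⟨hyz, hzblue⟩
    have hyr : y ≠ r := by rintro rfl; simp [hr0] at hzy
    have hyw : y ≠ w := by rintro rfl; exact hry hrw
    have hyN : blueNeighbors G c' y = {z} := by
      obtain ⟨a, ha⟩ := Set.ncard_eq_one.mp hy
      change blueNeighbors G c y = {a} at ha
      rw [hother hyr hyw, ha]
      rw [ha] at hzy
      rw [Set.mem_singleton_iff.mp hzy]
    have hyzc : y ∈ blueNeighbors G c z := ⟨hyz.symm, by simpa only [Sym2.eq_swap] using hzblue⟩
    have hzr : z ≠ r := by rintro rfl; simp [hr0] at hyzc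
    have hφx : φ x = x := by
      have h0 : blueCount G c' (φ x) = 0 := by
        rw [blueCount_apply hφ, hcount hx.ne' hwx.symm, blueCount_eq_ncard, hx0, Set.ncard_empty]
      by_contra hne
      by_cases h₁ : φ x = r
      · rw [h₁] at h0; omega
      by_cases h₂ : φ x = w
      · rw [h₂] at h0; omega
      exact hpos h₁ hne (by rw [← hcount h₁ h₂, h0])
    have hφr : φ r = r ∨ φ r = y := by
      have h1 : blueCount G c' (φ r) = 1 := by rw [blueCount_apply hφ, hcr']
      by_cases h₁ : φ r = r
      · exact Or.inl h₁
      have h₂ : φ r ≠ w := by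
        intro h
        rw [h] at h1
        omega
      refine Or.inr (hyuniq _ ?_ (by rw [← hcount h₁ h₂, h1]))
      have := φ.map_adj_iff.mpr hx.symm
      rwa [hφx] at this
    have himg := blueNeighbors_apply hφ r
    rw [hr', Set.image_singleton] at himg
    rcases hφr with h | h
    · rw [h, hr', Set.singleton_eq_singleton_iff] at himg
      exact hdist φ h (preserves_of_preserves_recolour hc' hφ h himg.symm)
    · rw [h, hyN, Set.singleton_eq_singleton_iff] at himg
      have hzw := blueCount_apply hφ w
      rw [← himg, hcount hzr hwz.symm, hw', hk₀] at hzw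
      omega
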